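/- arXiv:2211.00950 — 2 statements merged into one kernel-verified Lean document; each statement's English description precedes it below -/
import Mathlib

section
/- Let k ∈ {1,…,8} and let λ = Σ_{i=1}^{8} a_i ϖ_i where the a_i are nonnegative integers and a_k = 0. Then T_{λ,k} ∩ ℤ = {1, 2, …, M_{λ,k}} if and only if for every integer t at least one of the following holds: (1) (λ+ρ−tϖ_k, α) > 0 for every α ∈ Φ⁺; (2) the number of α ∈ Φ⁺ with (λ+ρ−tϖ_k, α) < 0 equals the cardinality of Φ⁺_k and (λ+ρ−tϖ_k, α) ≠ 0 for every α ∈ Φ⁺; (3) there exists α ∈ Φ⁺ with (λ+ρ−tϖ_k, α) = 0. -/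
noncomputable section

/-- The ambient space ℝ^8. -/
abbrev V : Type := Fin 8 → ℝ

/-- The standard inner product on ℝ^8. -/
def ip (x y : V) : ℝ := ∑ i, x i * y i

/-- The standard basis vectors ε_1, …, ε_8 (indexed from 0). -/
def eps (i : Fin 8) : V := fun j => if j = i then 1 else 0

/-- The E8 root system: ±ε_i±ε_j (i<j) together with
    ½∑(−1)^{k(i)}ε_i where the number of minus signs is even. -/
def PhiE8 : Set V :=
  {α | (∃ i j : Fin 8, i < j ∧ ∃ s t : ℝ, (s = 1 ∨ s = -1) ∧ (t = 1 ∨ t = -1) ∧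
          α = s • eps i + t • eps j) ∨
       (∃ k : Fin 8 → Bool,
          Even ((Finset.univ.filter (fun i => k i = true)).card) ∧
          α = ∑ i, (if k i then (-(1 : ℝ)/2) else ((1 : ℝ)/2)) • eps i)}

/-- Simple roots α_1, …, α_8 of E8 (indexed from 0). -/
def sroot : Fin 8 → V :=
  ![(1/2 : ℝ) • (eps 0 - eps 1 - eps 2 - eps 3 - eps 4 - eps 5 - eps 6 + eps 7),
    eps 0 + eps 1,
    eps 1 - eps 0,
    eps 2 - eps 1,
    eps 3 - eps 2,
    eps 4 - eps 3,
    eps 5 - eps 4,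
    eps 6 - eps 5]

/-- Positive roots of E8: elements of Φ_{E8} that are nonnegative
    combinations of the simple roots. -/
def Pos8 : Set V :=
  {α | α ∈ PhiE8 ∧ ∃ c : Fin 8 → ℝ, (∀ i, 0 ≤ c i) ∧ α = ∑ i, c i • sroot i}

/-- Fundamental weights ϖ_1, …, ϖ_8 of E8 (indexed from 0). -/
def w8 : Fin 8 → V :=
  ![(2 : ℝ) • eps 7,
    (1/2 : ℝ) • (eps 0 + eps 1 + eps 2 + eps 3 + eps 4 + eps 5 + eps 6
      + (5 : ℝ) • eps 7),
    (1/2 : ℝ) • (-eps 0 + eps 1 + eps 2 + eps 3 + eps 4 + eps 5 + eps 6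
      + (7 : ℝ) • eps 7),
    eps 2 + eps 3 + eps 4 + eps 5 + eps 6 + (5 : ℝ) • eps 7,
    eps 3 + eps 4 + eps 5 + eps 6 + (4 : ℝ) • eps 7,
    eps 4 + eps 5 + eps 6 + (3 : ℝ) • eps 7,
    eps 5 + eps 6 + (2 : ℝ) • eps 7,
    eps 6 + eps 7]

/-- ρ = ϖ_1 + ⋯ + ϖ_8. -/
def rho8 : V := ∑ i, w8 i

/-- Φ⁺_k = {α ∈ Φ⁺ : (ϖ_k, α) ≠ 0}. -/
def PhiK8 (k : Fin 8) : Set V := {α ∈ Pos8 | ip (w8 k) α ≠ 0}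

/-- λ = ∑ a_i ϖ_i. -/
def lam8 (a : Fin 8 → ℕ) : V := ∑ i, (a i : ℝ) • w8 i

/-- T_{λ,k} = {(λ+ρ, α)/c_{α,k} : α ∈ Φ⁺_k}. -/
def T8 (a : Fin 8 → ℕ) (k : Fin 8) : Set ℝ :=
  {r | ∃ α ∈ PhiK8 k, r = ip (lam8 a + rho8) α / ip (w8 k) α}

/-- M_{λ,k} = max T_{λ,k} (the set is finite and nonempty, so max = sSup). -/
def M8 (a : Fin 8 → ℕ) (k : Fin 8) : ℝ := sSup (T8 a k)

/-- The condition T_{λ,k} ∩ ℤ = {1, 2, …, M_{λ,k}}. -/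
def ACM8 (a : Fin 8 → ℕ) (k : Fin 8) : Prop :=
  {n : ℤ | (n : ℝ) ∈ T8 a k} = {n : ℤ | 1 ≤ n ∧ (n : ℝ) ≤ M8 a k}

lemma ip_add_left (x y z : V) : ip (x + y) z = ip x z + ip y z := by
  simp [ip, add_mul, Finset.sum_add_distrib]

lemma ip_sub_left (x y z : V) : ip (x - y) z = ip x z - ip y z := by
  simp [ip, sub_mul, Finset.sum_sub_distrib]

lemma ip_smul_left (r : ℝ) (x z : V) : ip (r • x) z = r * ip x z := by
  simp [ip, mul_assoc, Finset.mul_sum]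

lemma ip_sum_left (f : Fin 8 → V) (z : V) : ip (∑ i, f i) z = ∑ i, ip (f i) z := by
  simp only [ip, Finset.sum_apply, Finset.sum_mul]
  exact Finset.sum_comm

lemma ip_sum_smul_right (x : V) (c : Fin 8 → ℝ) (f : Fin 8 → V) :
    ip x (∑ i, c i • f i) = ∑ i, c i * ip x (f i) := by
  simp only [ip, Finset.sum_apply, Finset.mul_sum, Pi.smul_apply, smul_eq_mul]
  rw [Finset.sum_comm]
  exact Finset.sum_congr rfl fun i _ => Finset.sum_congr rfl fun j _ => by ring

lemma ip_add_right (x y z : V) : ip x (y + z) = ip x y + ip x z := by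
  simp [ip, mul_add, Finset.sum_add_distrib]

lemma ip_sub_right (x y z : V) : ip x (y - z) = ip x y - ip x z := by
  simp [ip, mul_sub, Finset.sum_sub_distrib]

lemma ip_smul_right (r : ℝ) (x z : V) : ip x (r • z) = r * ip x z := by
  simp [ip, mul_left_comm, Finset.mul_sum]

lemma ip_eps (x : V) (j : Fin 8) : ip x (eps j) = x j := by
  simp [ip, eps]

lemma sum_smul_eps (c : Fin 8 → ℝ) : ∑ i, c i • eps i = c := by
  ext l
  simp [eps, Finset.sum_apply]

/-- The fundamental weights are dual to the simple roots. -/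
lemma ip_w8_sroot (i j : Fin 8) : ip (w8 i) (sroot j) = if i = j then 1 else 0 := by
  fin_cases i <;> fin_cases j <;>
    norm_num [w8, sroot, ip_add_right, ip_sub_right, ip_smul_right, ip_eps, eps, Fin.ext_iff]

lemma ip_w8_sum (k : Fin 8) (c : Fin 8 → ℝ) : ip (w8 k) (∑ i, c i • sroot i) = c k := by
  simp [ip_sum_smul_right, ip_w8_sroot]

lemma ip_lam8_add_rho8_sum (a : Fin 8 → ℕ) (c : Fin 8 → ℝ) :
    ip (lam8 a + rho8) (∑ i, c i • sroot i) = ∑ i, ((a i : ℝ) + 1) * c i := by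
  simp only [ip_add_left, lam8, rho8, ip_sum_left, ip_smul_left, ip_w8_sum, add_mul, one_mul,
    Finset.sum_add_distrib]

lemma zero_notMem_PhiE8 : (0 : V) ∉ PhiE8 := by
  rintro (⟨i, j, hij, s, t, hs, -, h⟩ | ⟨k, -, h⟩)
  · have h' := congrFun h i
    rcases hs with rfl | rfl <;> simp [eps, hij.ne] at h'
  · rw [sum_smul_eps] at h
    have h' := congrFun h 0
    cases hk : k 0 <;> norm_num [hk] at h'

lemma finite_PhiE8 : PhiE8.Finite := by
  refine (Set.Finite.pi' (ι := Fin 8) (t := fun _ => ({-1, -1 / 2, 0, 1 / 2, 1} : Set ℝ))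
    fun _ => by simp).subset ?_
  rintro α (⟨i, j, hij, s, t, hs, ht, rfl⟩ | ⟨k, -, rfl⟩) l
  · by_cases hi : l = i
    · subst hi
      rcases hs with rfl | rfl <;> simp [eps, hij.ne]
    · by_cases hj : l = j <;> rcases ht with rfl | rfl <;> simp_all [eps]
  · rw [sum_smul_eps]
    cases k l <;> simp

lemma finite_Pos8 : Pos8.Finite := finite_PhiE8.subset fun _ h => h.1

lemma sroot_mem_PhiE8 (k : Fin 8) : sroot k ∈ PhiE8 := by
  have short (i j : Fin 8) (hij : i < j) (s : ℝ) (hs : s = 1 ∨ s = -1) (k : Fin 8)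
      (h : sroot k = eps j + s • eps i) : sroot k ∈ PhiE8 :=
    Or.inl ⟨i, j, hij, s, 1, hs, Or.inl rfl, by rw [h, one_smul, add_comm]⟩
  fin_cases k
  · refine Or.inr ⟨![false, true, true, true, true, true, true, false], by decide, ?_⟩
    rw [sum_smul_eps]
    ext l
    fin_cases l <;> norm_num [sroot, eps, Fin.ext_iff]
  · exact short 0 1 (by decide) 1 (by simp) _ (by simp [sroot, add_comm])
  · exact short 0 1 (by decide) (-1) (by simp) _ (by simp [sroot, sub_eq_add_neg])
  · exact short 1 2 (by decide) (-1) (by simp) _ (by simp [sroot, sub_eq_add_neg])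
  · exact short 2 3 (by decide) (-1) (by simp) _ (by simp [sroot, sub_eq_add_neg])
  · exact short 3 4 (by decide) (-1) (by simp) _ (by simp [sroot, sub_eq_add_neg])
  · exact short 4 5 (by decide) (-1) (by simp) _ (by simp [sroot, sub_eq_add_neg])
  · exact short 5 6 (by decide) (-1) (by simp) _ (by simp [sroot, sub_eq_add_neg])

lemma sroot_eq_sum (k : Fin 8) :
    sroot k = ∑ i, (Pi.single k 1 : Fin 8 → ℝ) i • sroot i := by
  simp [Pi.single_apply]

lemma sroot_mem_Pos8 (k : Fin 8) : sroot k ∈ Pos8 :=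
  ⟨sroot_mem_PhiE8 k, Pi.single k 1, fun i => by
    by_cases h : i = k <;> simp [h], sroot_eq_sum k⟩

lemma sroot_mem_PhiK8 (k : Fin 8) : sroot k ∈ PhiK8 k :=
  ⟨sroot_mem_Pos8 k, by simp [ip_w8_sroot]⟩

lemma ip_w8_nonneg (k : Fin 8) {α : V} (hα : α ∈ Pos8) : 0 ≤ ip (w8 k) α := by
  obtain ⟨-, c, hc, rfl⟩ := hα
  rw [ip_w8_sum]
  exact hc k

lemma ip_w8_pos {k : Fin 8} {α : V} (hα : α ∈ PhiK8 k) : 0 < ip (w8 k) α :=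
  (ip_w8_nonneg k hα.1).lt_of_ne' hα.2

lemma ip_lam8_add_rho8_pos (a : Fin 8 → ℕ) {α : V} (hα : α ∈ Pos8) :
    0 < ip (lam8 a + rho8) α := by
  obtain ⟨hΦ, c, hc, rfl⟩ := hα
  rw [ip_lam8_add_rho8_sum]
  have hne : ∃ i, c i ≠ 0 := by
    by_contra! h
    exact zero_notMem_PhiE8 (by simpa [h] using hΦ)
  obtain ⟨i, hi⟩ := hne
  refine Finset.sum_pos' (fun j _ => mul_nonneg (by positivity) (hc j))
    ⟨i, Finset.mem_univ i, mul_pos (by positivity) ((hc i).lt_of_ne' hi)⟩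

lemma ip_lam8_add_rho8_sroot (a : Fin 8 → ℕ) (k : Fin 8) :
    ip (lam8 a + rho8) (sroot k) = a k + 1 := by
  rw [sroot_eq_sum, ip_lam8_add_rho8_sum]
  simp [Pi.single_apply]

lemma ip_sub_smul_w8 (a : Fin 8 → ℕ) (k : Fin 8) (t : ℝ) (α : V) :
    ip (lam8 a + rho8 - t • w8 k) α = ip (lam8 a + rho8) α - t * ip (w8 k) α := by
  rw [ip_sub_left, ip_smul_left]

lemma finite_T8 (a : Fin 8 → ℕ) (k : Fin 8) : (T8 a k).Finite := by
  refine ((finite_Pos8.subset fun _ h => h.1 : (PhiK8 k).Finite).image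
    fun α => ip (lam8 a + rho8) α / ip (w8 k) α).subset ?_
  rintro r ⟨α, hα, rfl⟩
  exact ⟨α, hα, rfl⟩

lemma M8_mem_T8 (a : Fin 8 → ℕ) (k : Fin 8) : M8 a k ∈ T8 a k :=
  Set.Nonempty.csSup_mem ⟨_, sroot k, sroot_mem_PhiK8 k, rfl⟩ (finite_T8 a k)

lemma le_M8 {a : Fin 8 → ℕ} {k : Fin 8} {r : ℝ} (hr : r ∈ T8 a k) : r ≤ M8 a k :=
  le_csSup (finite_T8 a k).bddAbove hr

lemma pos_of_mem_T8 {a : Fin 8 → ℕ} {k : Fin 8} {r : ℝ} (hr : r ∈ T8 a k) : 0 < r := by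
  obtain ⟨α, hα, rfl⟩ := hr
  exact div_pos (ip_lam8_add_rho8_pos a hα.1) (ip_w8_pos hα)

/-- The weight `λ + ρ - tϖ_k` is singular exactly when `t ∈ T_{λ,k}`. -/
lemma exists_ip_eq_zero_iff (a : Fin 8 → ℕ) (k : Fin 8) (t : ℝ) :
    (∃ α ∈ Pos8, ip (lam8 a + rho8 - t • w8 k) α = 0) ↔ t ∈ T8 a k := by
  simp only [ip_sub_smul_w8]
  constructor
  · rintro ⟨α, hα, h⟩
    have hne : ip (w8 k) α ≠ 0 := fun h0 => by
      have := ip_lam8_add_rho8_pos a hα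
      simp only [h0, mul_zero, sub_zero] at h
      exact this.ne' h
    exact ⟨α, ⟨hα, hne⟩, by rw [eq_div_iff hne]; linarith⟩
  · rintro ⟨α, hα, rfl⟩
    exact ⟨α, hα.1, by rw [div_mul_cancel₀ _ hα.2, sub_self]⟩

/-- Exactly `|Φ⁺_k|` positive roots are negative on `λ + ρ - tϖ_k` iff `t` exceeds `M_{λ,k}`. -/
lemma ncard_neg_eq_iff (a : Fin 8 → ℕ) (k : Fin 8) (t : ℝ) :
    {α ∈ Pos8 | ip (lam8 a + rho8 - t • w8 k) α < 0}.ncard = (PhiK8 k).ncard ↔ M8 a k < t := by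
  have hfin : (PhiK8 k).Finite := finite_Pos8.subset fun _ h => h.1
  have hsub : {α ∈ Pos8 | ip (lam8 a + rho8 - t • w8 k) α < 0} ⊆ PhiK8 k := by
    rintro α ⟨hα, h⟩
    refine ⟨hα, fun h0 => ?_⟩
    rw [ip_sub_smul_w8, h0, mul_zero, sub_zero] at h
    exact h.not_gt (ip_lam8_add_rho8_pos a hα)
  constructor
  · intro hcard
    have heq := Set.eq_of_subset_of_ncard_le hsub hcard.ge hfin
    obtain ⟨α, hα, hM⟩ := M8_mem_T8 a k
    have hneg := (heq.symm ▸ hα : α ∈ {α ∈ Pos8 | _}).2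
    rw [ip_sub_smul_w8] at hneg
    rw [hM, div_lt_iff₀ (ip_w8_pos hα)]
    linarith
  · intro hM
    congr 1
    refine hsub.antisymm fun α hα => ⟨hα.1, ?_⟩
    have hlt := (le_M8 ⟨α, hα, rfl⟩).trans_lt hM
    rw [div_lt_iff₀ (ip_w8_pos hα)] at hlt
    rw [ip_sub_smul_w8]
    linarith

/-- the Borel–Weil–Bott criterion for `T_{λ,k} ∩ ℤ = [1, M_{λ,k}]`
    on E8/P_{α_k}. -/
theorem stmt2 (k : Fin 8) (a : Fin 8 → ℕ) (hk : a k = 0) :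
    ACM8 a k ↔
      ∀ t : ℤ,
        (∀ α ∈ Pos8, 0 < ip (lam8 a + rho8 - (t : ℝ) • w8 k) α) ∨
        ({α ∈ Pos8 | ip (lam8 a + rho8 - (t : ℝ) • w8 k) α < 0}.ncard
            = (PhiK8 k).ncard ∧
          ∀ α ∈ Pos8, ip (lam8 a + rho8 - (t : ℝ) • w8 k) α ≠ 0) ∨
        (∃ α ∈ Pos8, ip (lam8 a + rho8 - (t : ℝ) • w8 k) α = 0) := by
  constructor
  · intro hACM t
    rcases le_or_gt t 0 with ht | ht
    · refine Or.inl fun α hα => ?_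
      have ht' : (t : ℝ) ≤ 0 := by exact_mod_cast ht
      rw [ip_sub_smul_w8]
      linarith [ip_lam8_add_rho8_pos a hα, mul_nonpos_of_nonpos_of_nonneg ht' (ip_w8_nonneg k hα)]
    · refine Or.inr ?_
      by_cases hT : (t : ℝ) ∈ T8 a k
      · exact Or.inr ((exists_ip_eq_zero_iff a k t).2 hT)
      · refine Or.inl ⟨(ncard_neg_eq_iff a k t).2 ?_, fun α hα h =>
          hT ((exists_ip_eq_zero_iff a k t).1 ⟨α, hα, h⟩)⟩
        by_contra! hle
        exact hT ((Set.ext_iff.1 hACM t).2 ⟨ht, hle⟩)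
  · intro H
    ext n
    constructor
    · intro hn
      have hpos : (0 : ℝ) < n := pos_of_mem_T8 hn
      exact ⟨by exact_mod_cast hpos, le_M8 hn⟩
    · rintro ⟨hn, hnM⟩
      have hn' : (1 : ℝ) ≤ n := by exact_mod_cast hn
      rcases H n with h | ⟨h, -⟩ | h
      · have := h _ (sroot_mem_Pos8 k)
        rw [ip_sub_smul_w8, ip_lam8_add_rho8_sroot, ip_w8_sroot, hk] at this
        simp only [if_true, Nat.cast_zero] at this
        linarith
      · exact absurd ((ncard_neg_eq_iff a k n).1 h) hnM.not_gt
      · exact (exists_ip_eq_zero_iff a k n).1 h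
end
end

section
/- Let λ = Σ_{i=1}^{7} a_i ϖ_i with all a_i nonnegative integers and a_7 = 0. Then T_{λ,7} ∩ ℤ = {1, 2, …, M_{λ,7}} if and only if (a_1,a_2,a_3,a_4,a_5,a_6,a_7) = (0,i,0,0,0,0,0) for some i ∈ {0,1,2}. (This is the combinatorial criterion, via the main theorem, for an initialized irreducible homogeneous vector bundle on the Freudenthal variety E7/P_{α_7} with highest weight λ to be an ACM bundle.) -/
noncomputable section

/-- The simple roots α_1, …, α_7 of E7. -/
def sroot7 : Fin 7 → V := fun i => sroot (Fin.castLE (by norm_num) i)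

/-- The E7 root system: Φ_{E8} ∩ span_ℝ{α_1,…,α_7}. -/
def PhiE7 : Set V :=
  {α | α ∈ PhiE8 ∧ α ∈ Submodule.span ℝ (Set.range sroot7)}

/-- Positive roots of E7: elements of Φ_{E7} that are nonnegative
    combinations of the simple roots. -/
def Pos7 : Set V :=
  {α | α ∈ PhiE7 ∧ ∃ c : Fin 7 → ℝ, (∀ i, 0 ≤ c i) ∧ α = ∑ i, c i • sroot7 i}

/-- Fundamental weights ϖ_1, …, ϖ_7 of E7 (indexed from 0). -/
def w7 : Fin 7 → V :=
  ![-eps 6 + eps 7,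
    (1/2 : ℝ) • (eps 0 + eps 1 + eps 2 + eps 3 + eps 4 + eps 5) - eps 6 + eps 7,
    (1/2 : ℝ) • (-eps 0 + eps 1 + eps 2 + eps 3 + eps 4 + eps 5
      - (3 : ℝ) • eps 6 + (3 : ℝ) • eps 7),
    eps 2 + eps 3 + eps 4 + eps 5 - (2 : ℝ) • eps 6 + (2 : ℝ) • eps 7,
    eps 3 + eps 4 + eps 5 - (3/2 : ℝ) • (eps 6 - eps 7),
    eps 4 + eps 5 - eps 6 + eps 7,
    eps 5 - (1/2 : ℝ) • (eps 6 - eps 7)]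

/-- ρ = ϖ_1 + ⋯ + ϖ_7. -/
def rho7 : V := ∑ i, w7 i

/-- Φ⁺_k = {α ∈ Φ⁺ : (ϖ_k, α) ≠ 0}. -/
def PhiK7 (k : Fin 7) : Set V := {α ∈ Pos7 | ip (w7 k) α ≠ 0}

/-- λ = ∑ a_i ϖ_i. -/
def lam7 (a : Fin 7 → ℕ) : V := ∑ i, (a i : ℝ) • w7 i

/-- T_{λ,k} = {(λ+ρ, α)/c_{α,k} : α ∈ Φ⁺_k}. -/
def T7 (a : Fin 7 → ℕ) (k : Fin 7) : Set ℝ :=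
  {r | ∃ α ∈ PhiK7 k, r = ip (lam7 a + rho7) α / ip (w7 k) α}

/-- M_{λ,k} = max T_{λ,k} (the set is finite and nonempty, so max = sSup). -/
def M7 (a : Fin 7 → ℕ) (k : Fin 7) : ℝ := sSup (T7 a k)

/-- The condition T_{λ,k} ∩ ℤ = {1, 2, …, M_{λ,k}}. -/
def ACM7 (a : Fin 7 → ℕ) (k : Fin 7) : Prop :=
  {n : ℤ | (n : ℝ) ∈ T7 a k} = {n : ℤ | 1 ≤ n ∧ (n : ℝ) ≤ M7 a k}

/-- Coordinates, in the basis of simple roots, of the positive roots of E7 in which the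
    last simple root occurs. -/
def rootCoords : List (Fin 7 → ℕ) :=
  [![0, 0, 0, 0, 0, 0, 1], ![0, 0, 0, 0, 0, 1, 1], ![0, 0, 0, 0, 1, 1, 1],
    ![0, 0, 0, 1, 1, 1, 1], ![0, 0, 1, 1, 1, 1, 1], ![0, 1, 0, 1, 1, 1, 1],
    ![0, 1, 1, 1, 1, 1, 1], ![1, 0, 1, 1, 1, 1, 1], ![0, 1, 1, 2, 1, 1, 1],
    ![1, 1, 1, 1, 1, 1, 1], ![0, 1, 1, 2, 2, 1, 1], ![1, 1, 1, 2, 1, 1, 1],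
    ![0, 1, 1, 2, 2, 2, 1], ![1, 1, 1, 2, 2, 1, 1], ![1, 1, 2, 2, 1, 1, 1],
    ![1, 1, 1, 2, 2, 2, 1], ![1, 1, 2, 2, 2, 1, 1], ![1, 1, 2, 2, 2, 2, 1],
    ![1, 1, 2, 3, 2, 1, 1], ![1, 1, 2, 3, 2, 2, 1], ![1, 2, 2, 3, 2, 1, 1],
    ![1, 1, 2, 3, 3, 2, 1], ![1, 2, 2, 3, 2, 2, 1], ![1, 2, 2, 3, 3, 2, 1],
    ![1, 2, 2, 4, 3, 2, 1], ![1, 2, 3, 4, 3, 2, 1], ![2, 2, 3, 4, 3, 2, 1]]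

/-- Twice the simple roots of E7, in integer coordinates. -/
def twiceSroot : Fin 7 → Fin 8 → ℤ :=
  ![![1, -1, -1, -1, -1, -1, -1, 1], ![2, 2, 0, 0, 0, 0, 0, 0], ![-2, 2, 0, 0, 0, 0, 0, 0],
    ![0, -2, 2, 0, 0, 0, 0, 0], ![0, 0, -2, 2, 0, 0, 0, 0], ![0, 0, 0, -2, 2, 0, 0, 0],
    ![0, 0, 0, 0, -2, 2, 0, 0]]

/-- Twice the fundamental weights of E7, in integer coordinates. -/
def twiceWeight : Fin 7 → Fin 8 → ℤ :=
  ![![0, 0, 0, 0, 0, 0, -2, 2], ![1, 1, 1, 1, 1, 1, -2, 2], ![-1, 1, 1, 1, 1, 1, -3, 3],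
    ![0, 0, 2, 2, 2, 2, -4, 4], ![0, 0, 0, 2, 2, 2, -3, 3], ![0, 0, 0, 0, 2, 2, -2, 2],
    ![0, 0, 0, 0, 0, 2, -1, 1]]

/-- Twice the vector `s ε_i + t ε_j`. -/
def twicePair (i j : Fin 8) (s t : ℤ) : Fin 8 → ℤ :=
  fun n => 2 * ((if n = i then s else 0) + (if n = j then t else 0))

/-- Twice the vector `½ ∑ (-1)^{k(i)} ε_i`. -/
def twiceSpin (k : Fin 8 → Bool) : Fin 8 → ℤ := fun n => if k n then -1 else 1

lemma sroot7_apply (m : Fin 7) (n : Fin 8) : sroot7 m n = (twiceSroot m n : ℝ) / 2 := by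
  fin_cases m <;> fin_cases n <;>
    norm_num [sroot7, sroot, twiceSroot, eps, Fin.ext_iff, Fin.castLE]

lemma w7_apply (m : Fin 7) (n : Fin 8) : w7 m n = (twiceWeight m n : ℝ) / 2 := by
  fin_cases m <;> fin_cases n <;> norm_num [w7, twiceWeight, eps, Fin.ext_iff]

lemma pair_apply (i j n : Fin 8) (s t : ℤ) :
    ((s : ℝ) • eps i + (t : ℝ) • eps j) n = (twicePair i j s t n : ℝ) / 2 := by
  simp [eps, twicePair]

lemma spin_apply (k : Fin 8 → Bool) (n : Fin 8) :
    (∑ i, (if k i then (-(1 : ℝ)/2) else ((1 : ℝ)/2)) • eps i) n = (twiceSpin k n : ℝ) / 2 := by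
  rw [Finset.sum_apply]
  simp only [Pi.smul_apply, eps, smul_eq_mul, mul_ite, mul_one, mul_zero, Finset.sum_ite_eq,
    Finset.mem_univ, if_true, twiceSpin]
  split <;> simp

lemma twiceWeight_dual : ∀ m l : Fin 7,
    ∑ n, twiceWeight m n * twiceSroot l n = if m = l then 4 else 0 := by
  decide +kernel

lemma ip_w7_sroot7 (m l : Fin 7) : ip (w7 m) (sroot7 l) = if m = l then 1 else 0 := by
  have h : ((∑ n, twiceWeight m n * twiceSroot l n : ℤ) : ℝ) = (if m = l then 4 else 0 : ℤ) := by
    rw [twiceWeight_dual]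
  have h' : ip (w7 m) (sroot7 l) = (∑ n, twiceWeight m n * twiceSroot l n : ℤ) / 4 := by
    simp only [ip, w7_apply, sroot7_apply]
    push_cast
    rw [Finset.sum_div]
    exact Finset.sum_congr rfl fun n _ => by ring
  rw [h', h]
  split <;> simp

lemma ip_sum_right {ι : Type*} (s : Finset ι) (x : V) (c : ι → ℝ) (v : ι → V) :
    ip x (∑ i ∈ s, c i • v i) = ∑ i ∈ s, c i * ip x (v i) := by
  simp only [ip, Finset.sum_apply, Pi.smul_apply, smul_eq_mul, Finset.mul_sum]
  rw [Finset.sum_comm]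
  exact Finset.sum_congr rfl fun i _ => Finset.sum_congr rfl fun n _ => by ring

lemma ip_comm (x y : V) : ip x y = ip y x :=
  Finset.sum_congr rfl fun _ _ => mul_comm _ _

lemma ip_w7_sum (m : Fin 7) (c : Fin 7 → ℝ) : ip (w7 m) (∑ i, c i • sroot7 i) = c m := by
  simp [ip_sum_right, ip_w7_sroot7]

lemma ip_lam_add_rho (a : Fin 7 → ℕ) (c : Fin 7 → ℝ) :
    ip (lam7 a + rho7) (∑ i, c i • sroot7 i) = ∑ i, c i * (a i + 1) := by
  have h : lam7 a + rho7 = ∑ i, ((a i : ℝ) + 1) • w7 i := by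
    simp [lam7, rho7, add_smul, Finset.sum_add_distrib]
  rw [h, ip_comm, ip_sum_right]
  exact Finset.sum_congr rfl fun i _ => by rw [ip_comm, ip_w7_sum, mul_comm]

lemma pair_mem_rootCoords : ∀ i j : Fin 8, i < j → ∀ s ∈ [(1 : ℤ), -1], ∀ t ∈ [(1 : ℤ), -1],
    twicePair i j s t 6 + twicePair i j s t 7 = 0 →
    (∀ m, 0 ≤ ∑ n, twiceWeight m n * twicePair i j s t n) →
    ∑ n, twiceWeight 6 n * twicePair i j s t n ≠ 0 →
    ∃ c ∈ rootCoords, ∀ m, ∑ n, twiceWeight m n * twicePair i j s t n = 4 * c m := by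
  decide +kernel

lemma spin_mem_rootCoords : ∀ k : Fin 8 → Bool,
    Even ((Finset.univ.filter (fun i => k i = true)).card) →
    twiceSpin k 6 + twiceSpin k 7 = 0 →
    (∀ m, 0 ≤ ∑ n, twiceWeight m n * twiceSpin k n) →
    ∑ n, twiceWeight 6 n * twiceSpin k n ≠ 0 →
    ∃ c ∈ rootCoords, ∀ m, ∑ n, twiceWeight m n * twiceSpin k n = 4 * c m := by
  decide +kernel

lemma rootCoords_root : ∀ c ∈ rootCoords, c 6 = 1 ∧
    ((∃ i j : Fin 8, i < j ∧ ∃ s ∈ [(1 : ℤ), -1], ∃ t ∈ [(1 : ℤ), -1],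
      ∀ n, ∑ m, (c m : ℤ) * twiceSroot m n = twicePair i j s t n) ∨
    (Even ((Finset.univ.filter
        (fun n => decide (∑ m, (c m : ℤ) * twiceSroot m n < 0) = true)).card) ∧
      ∀ n, ∑ m, (c m : ℤ) * twiceSroot m n =
        twiceSpin (fun n => decide (∑ m, (c m : ℤ) * twiceSroot m n < 0)) n)) := by
  decide +kernel

lemma exists_twice_of_mem_PhiE8 {α : V} (h : α ∈ PhiE8) : ∃ z : Fin 8 → ℤ,
    (∀ n, α n = (z n : ℝ) / 2) ∧
    (z 6 + z 7 = 0 → (∀ m, 0 ≤ ∑ n, twiceWeight m n * z n) → ∑ n, twiceWeight 6 n * z n ≠ 0 →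
      ∃ c ∈ rootCoords, ∀ m, ∑ n, twiceWeight m n * z n = 4 * c m) := by
  rcases h with ⟨i, j, hij, s, t, hs, ht, rfl⟩ | ⟨k, hk, rfl⟩
  · obtain ⟨s, rfl, hs'⟩ : ∃ s' : ℤ, s = s' ∧ s' ∈ [(1 : ℤ), -1] := by
      rcases hs with rfl | rfl
      exacts [⟨1, by simp⟩, ⟨-1, by simp⟩]
    obtain ⟨t, rfl, ht'⟩ : ∃ t' : ℤ, t = t' ∧ t' ∈ [(1 : ℤ), -1] := by
      rcases ht with rfl | rfl
      exacts [⟨1, by simp⟩, ⟨-1, by simp⟩]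
    exact ⟨_, fun n => pair_apply i j n s t, pair_mem_rootCoords i j hij s hs' t ht'⟩
  · exact ⟨_, spin_apply k, spin_mem_rootCoords k hk⟩

lemma mem_PhiK7_iff (α : V) :
    α ∈ PhiK7 6 ↔ ∃ c ∈ rootCoords, α = ∑ i, (c i : ℝ) • sroot7 i := by
  constructor
  · rintro ⟨⟨⟨hα, -⟩, c, hc, hsum⟩, h6⟩
    obtain ⟨z, hz, hmem⟩ := exists_twice_of_mem_PhiE8 hα
    have hpair (m : Fin 7) : ((∑ n, twiceWeight m n * z n : ℤ) : ℝ) = 4 * c m := by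
      rw [← ip_w7_sum m c, ← hsum]
      simp only [ip, w7_apply, hz, Finset.mul_sum]
      push_cast
      exact Finset.sum_congr rfl fun n _ => by ring
    have horth : z 6 + z 7 = 0 := by
      have h : α 6 + α 7 = 0 := by
        rw [hsum]
        simp [Fin.sum_univ_succ, sroot7_apply, twiceSroot]
        ring
      rw [hz, hz] at h
      have h' : ((z 6 + z 7 : ℤ) : ℝ) = 0 := by
        push_cast
        linarith
      exact_mod_cast h'
    obtain ⟨d, hd, hdc⟩ := hmem horth
      (fun m => by
        have h := hpair m
        have := hc m
        exact_mod_cast (by rw [h]; positivity :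
          (0 : ℝ) ≤ ((∑ n, twiceWeight m n * z n : ℤ) : ℝ)))
      (fun h => by
        rw [hsum, ip_w7_sum] at h6
        have := hpair 6
        rw [h] at this
        apply h6
        push_cast at this
        linarith)
    refine ⟨d, hd, ?_⟩
    rw [hsum]
    refine Finset.sum_congr rfl fun m _ => ?_
    have h := hpair m
    rw [hdc m] at h
    push_cast at h
    rw [show c m = d m by linarith]
  · rintro ⟨c, hc, rfl⟩
    obtain ⟨h6, hroot⟩ := rootCoords_root c hc
    have happly (n : Fin 8) : (∑ m, (c m : ℝ) • sroot7 m) n =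
        ((∑ m, (c m : ℤ) * twiceSroot m n : ℤ) : ℝ) / 2 := by
      rw [Finset.sum_apply]
      simp only [Pi.smul_apply, smul_eq_mul, sroot7_apply]
      push_cast
      rw [Finset.sum_div]
      exact Finset.sum_congr rfl fun m _ => by ring
    refine ⟨⟨⟨?_, ?_⟩, fun m => c m, fun m => Nat.cast_nonneg _, rfl⟩, ?_⟩
    · rcases hroot with ⟨i, j, hij, s, hs, t, ht, h⟩ | ⟨heven, h⟩
      · refine Or.inl ⟨i, j, hij, s, t, ?_, ?_, ?_⟩
        · rcases (by simpa using hs : s = 1 ∨ s = -1) with rfl | rfl <;> simp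
        · rcases (by simpa using ht : t = 1 ∨ t = -1) with rfl | rfl <;> simp
        · funext n
          rw [happly, h, pair_apply]
      · refine Or.inr ⟨_, heven, ?_⟩
        funext n
        rw [happly, spin_apply, ← h]
    · exact Submodule.sum_mem _ fun m _ =>
        Submodule.smul_mem _ _ (Submodule.subset_span ⟨m, rfl⟩)
    · rw [ip_w7_sum 6 fun m => (c m : ℝ), h6]
      simp

lemma mem_T7_iff (a : Fin 7 → ℕ) (r : ℝ) :
    r ∈ T7 a 6 ↔ ∃ c ∈ rootCoords, r = ((∑ i, c i * (a i + 1) : ℕ) : ℝ) := by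
  have hval (c : Fin 7 → ℕ) (hc : c ∈ rootCoords) :
      ip (lam7 a + rho7) (∑ i, (c i : ℝ) • sroot7 i) / ip (w7 6) (∑ i, (c i : ℝ) • sroot7 i) =
        ((∑ i, c i * (a i + 1) : ℕ) : ℝ) := by
    rw [ip_lam_add_rho a fun m => (c m : ℝ), ip_w7_sum 6 fun m => (c m : ℝ),
      (rootCoords_root c hc).1]
    simp
  constructor
  · rintro ⟨α, hα, rfl⟩
    obtain ⟨c, hc, rfl⟩ := (mem_PhiK7_iff α).1 hα
    exact ⟨c, hc, hval c hc⟩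
  · rintro ⟨c, hc, rfl⟩
    exact ⟨_, (mem_PhiK7_iff _).2 ⟨c, hc, rfl⟩, (hval c hc).symm⟩

/-- The pairing of `λ + ρ` with the highest root is the maximum of `T7 a 6`. -/
lemma M7_eq (a : Fin 7 → ℕ) :
    M7 a 6 = ((∑ i, ![2, 2, 3, 4, 3, 2, 1] i * (a i + 1) : ℕ) : ℝ) := by
  refine IsGreatest.csSup_eq ⟨(mem_T7_iff a _).2 ⟨_, ?_, rfl⟩, ?_⟩
  · simp [rootCoords]
  · intro r hr
    obtain ⟨c, hc, rfl⟩ := (mem_T7_iff a r).1 hr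
    have hle : ∀ c ∈ rootCoords, ∀ i, c i ≤ (![2, 2, 3, 4, 3, 2, 1] : Fin 7 → ℕ) i := by
      decide +kernel
    exact_mod_cast Finset.sum_le_sum fun i _ => Nat.mul_le_mul_right _ (hle c hc i)

lemma ACM7_iff (a : Fin 7 → ℕ) :
    ACM7 a 6 ↔ ∀ n : ℕ, (∃ c ∈ rootCoords, n = ∑ i, c i * (a i + 1)) ↔
      1 ≤ n ∧ n ≤ ∑ i, ![2, 2, 3, 4, 3, 2, 1] i * (a i + 1) := by
  simp only [ACM7, Set.ext_iff, Set.mem_ofPred_eq, mem_T7_iff, M7_eq]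
  constructor
  · intro h n
    have := h n
    norm_cast at this
  · intro h n
    rcases le_or_gt 0 n with hn | hn
    · lift n to ℕ using hn
      norm_cast
      exact h n
    · refine iff_of_false ?_ (by omega)
      rintro ⟨c, -, hc⟩
      have : n = ((∑ i, c i * (a i + 1) : ℕ) : ℤ) := by exact_mod_cast hc
      omega

/-- the ACM criterion on the Freudenthal variety E7/P_{α_7}
    (k = 7 is indexed here by 6). -/
theorem stmt15 (a : Fin 7 → ℕ) (h : a 6 = 0) :
    ACM7 a 6 ↔
      ∃ i : ℕ, i ≤ 2 ∧ a = ![0, i, 0, 0, 0, 0, 0] := by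
  rw [ACM7_iff]
  constructor
  · intro H
    simp only [rootCoords, List.exists_mem_cons_iff, List.not_mem_nil, false_and, exists_false,
      or_false, Fin.sum_univ_seven, Matrix.cons_val, h] at H
    have h5 : a 5 = 0 := by have := (H 2).2; omega
    have h4 : a 4 = 0 := by have := (H 3).2; omega
    have h3 : a 3 = 0 := by have := (H 4).2; omega
    have h0 : a 0 = 0 := by
      have := (H (16 + 2 * a 0 + 2 * a 1 + 3 * a 2)).2
      omega
    have h2 : a 2 = 0 := by
      have := (H (15 + 2 * a 1 + 3 * a 2)).2
      omega
    have h1 : a 1 ≤ 2 := by have := (H 7).2; omega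
    refine ⟨a 1, h1, ?_⟩
    funext m
    fin_cases m <;> simp [*]
  · rintro ⟨i, hi, rfl⟩ n
    simp only [rootCoords, List.exists_mem_cons_iff, List.not_mem_nil, false_and, exists_false,
      or_false, Fin.sum_univ_seven, Matrix.cons_val]
    interval_cases i <;> omega
end
end
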